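/- Let f : 2^{[k]} → ℝ be submodular, increasing, and normalized. Then for every v ∈ V = {−1,0,1}^k and every y ∈ {−1,1}^k, the Lovász hinge satisfies L^f(v, y) = f({i ∈ [k] : v_i y_i < 0}) + f({i ∈ [k] : v_i y_i ≤ 0}). -/

import Mathlib

open Finset

noncomputable section

/-- The set {π(1),…,π(i)} of the first `i` elements under permutation `π`. -/
def Spi (k : ℕ) (π : Equiv.Perm (Fin k)) (i : ℕ) : Finset (Fin k) :=
  (Finset.univ.filter (fun m : Fin k => (m : ℕ) < i)).image π

/-- The Lovász extension of a set function `f`. -/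
def lovaszExt (k : ℕ) (f : Finset (Fin k) → ℝ) (x : Fin k → ℝ) : ℝ :=
  Finset.univ.sup' Finset.univ_nonempty
    (fun π : Equiv.Perm (Fin k) =>
      ∑ i : Fin k, x (π i) * (f (Spi k π ((i : ℕ) + 1)) - f (Spi k π (i : ℕ))))

/-- The Lovász hinge `L^f(u,y) = F((𝟙 - u ⊙ y)₊)`. -/
def lovaszHinge (k : ℕ) (f : Finset (Fin k) → ℝ) (u y : Fin k → ℝ) : ℝ :=
  lovaszExt k f (fun i => max (1 - u i * y i) 0)

theorem Spi_zero (k : ℕ) (π : Equiv.Perm (Fin k)) : Spi k π 0 = ∅ := by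
  simp [Spi]

theorem Spi_self (k : ℕ) (π : Equiv.Perm (Fin k)) : Spi k π k = univ := by
  simp [Spi]

theorem apply_mem_Spi {k : ℕ} {π : Equiv.Perm (Fin k)} {i : Fin k} {n : ℕ} :
    π i ∈ Spi k π n ↔ (i : ℕ) < n := by
  simp [Spi]

theorem Spi_succ (k : ℕ) (π : Equiv.Perm (Fin k)) (i : Fin k) :
    Spi k π ((i : ℕ) + 1) = insert (π i) (Spi k π i) := by
  ext a
  obtain ⟨j, rfl⟩ := π.surjective a
  rw [mem_insert, apply_mem_Spi, apply_mem_Spi, π.injective.eq_iff, Fin.ext_iff]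
  omega

theorem sum_Spi_inter_sub {k : ℕ} {f : Finset (Fin k) → ℝ} (hnorm : f ∅ = 0)
    (π : Equiv.Perm (Fin k)) (A : Finset (Fin k)) :
    ∑ i : Fin k, (f (Spi k π ((i : ℕ) + 1) ∩ A) - f (Spi k π i ∩ A)) = f A := by
  rw [Fin.sum_univ_eq_sum_range (fun n => f (Spi k π (n + 1) ∩ A) - f (Spi k π n ∩ A)),
    sum_range_sub (fun n => f (Spi k π n ∩ A)), Spi_zero, Spi_self]
  simp [hnorm]

/-- Each marginal vector of a submodular function lies below the function. -/
theorem sum_indicator_mul_marginal_le {k : ℕ} {f : Finset (Fin k) → ℝ}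
    (hsub : ∀ S T : Finset (Fin k), f (S ∪ T) + f (S ∩ T) ≤ f S + f T) (hnorm : f ∅ = 0)
    (π : Equiv.Perm (Fin k)) (A : Finset (Fin k)) :
    ∑ i : Fin k, (if π i ∈ A then (1 : ℝ) else 0) *
      (f (Spi k π ((i : ℕ) + 1)) - f (Spi k π i)) ≤ f A := by
  rw [← sum_Spi_inter_sub hnorm π A]
  refine sum_le_sum fun i _ => ?_
  have hi : π i ∉ Spi k π i := by simp [apply_mem_Spi]
  rw [Spi_succ]
  split_ifs with h
  · have hs := hsub (Spi k π i) (insert (π i) (Spi k π i) ∩ A)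
    have h1 : Spi k π i ∪ insert (π i) (Spi k π i) ∩ A = insert (π i) (Spi k π i) := by
      grind
    have h2 : Spi k π i ∩ (insert (π i) (Spi k π i) ∩ A) = Spi k π i ∩ A := by
      grind
    rw [h1, h2] at hs
    linarith
  · rw [insert_inter_of_notMem h]
    simp

/-- The marginal vector of an ordering attains the function on the initial segments. -/
theorem sum_indicator_mul_marginal_eq {k : ℕ} {f : Finset (Fin k) → ℝ} (hnorm : f ∅ = 0)
    (π : Equiv.Perm (Fin k)) (A : Finset (Fin k)) (hA : ∀ i j, i ≤ j → π j ∈ A → π i ∈ A) :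
    ∑ i : Fin k, (if π i ∈ A then (1 : ℝ) else 0) *
      (f (Spi k π ((i : ℕ) + 1)) - f (Spi k π i)) = f A := by
  rw [← sum_Spi_inter_sub hnorm π A]
  refine sum_congr rfl fun i _ => ?_
  rw [Spi_succ]
  split_ifs with h
  · have hS : Spi k π i ⊆ A := by
      intro a ha
      obtain ⟨j, rfl⟩ := π.surjective a
      exact hA j i (apply_mem_Spi.1 ha).le h
    rw [inter_eq_left.2 hS, inter_eq_left.2 (insert_subset h hS), one_mul]
  · rw [insert_inter_of_notMem h]
    simp

/-- The Lovász extension is additive on indicators of nested sets. -/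
theorem lovaszExt_indicator_add_indicator {k : ℕ} {f : Finset (Fin k) → ℝ}
    (hsub : ∀ S T : Finset (Fin k), f (S ∪ T) + f (S ∩ T) ≤ f S + f T) (hnorm : f ∅ = 0)
    {A B : Finset (Fin k)} (hAB : A ⊆ B) :
    lovaszExt k f (fun i => (if i ∈ A then (1 : ℝ) else 0) + if i ∈ B then (1 : ℝ) else 0) =
      f A + f B := by
  apply le_antisymm
  · refine sup'_le _ _ fun π _ => ?_
    simp only [add_mul, sum_add_distrib]
    exact add_le_add (sum_indicator_mul_marginal_le hsub hnorm π A)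
      (sum_indicator_mul_marginal_le hsub hnorm π B)
  · let key : Fin k → ℕ := fun i => (if i ∈ A then 0 else 1) + if i ∈ B then 0 else 1
    have hkey : Monotone (key ∘ Tuple.sort key) := Tuple.monotone_sort key
    refine le_sup'_of_le _ (mem_univ (Tuple.sort key)) ?_
    simp only [add_mul, sum_add_distrib]
    rw [sum_indicator_mul_marginal_eq hnorm _ A, sum_indicator_mul_marginal_eq hnorm _ B]
    all_goals
      intro i j hij hj
      have hle := hkey hij
      simp only [Function.comp_apply, key] at hle
      grind

/-- on `V = {-1,0,1}^k` the Lovász hinge equals the structured abstain loss. -/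
theorem stmt5 (k : ℕ) (hk : 1 ≤ k) (f : Finset (Fin k) → ℝ)
    (hsub : ∀ S T : Finset (Fin k), f (S ∪ T) + f (S ∩ T) ≤ f S + f T)
    (hinc : ∀ S T : Finset (Fin k), Disjoint S T → f S ≤ f (S ∪ T))
    (hnorm : f ∅ = 0)
    (v y : Fin k → ℝ)
    (hv : ∀ i, v i = -1 ∨ v i = 0 ∨ v i = 1) (hy : ∀ i, y i = -1 ∨ y i = 1) :
    lovaszHinge k f v y =
      f (Finset.univ.filter (fun i => v i * y i < 0)) +
        f (Finset.univ.filter (fun i => v i * y i ≤ 0)) := by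
  rw [← lovaszExt_indicator_add_indicator hsub hnorm
    (monotone_filter_right univ fun _ _ h => le_of_lt h), lovaszHinge]
  congr 1
  funext i
  rcases hv i with h | h | h <;> rcases hy i with h' | h' <;> norm_num [h, h']
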